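/- arXiv:2001.02022 — 2 statements merged into one kernel-verified Lean document; each statement's English description precedes it below -/
import Mathlib

section
/- For every integer k with 1 ≤ k ≤ n, the function g_k defined by g_k(ξ) = inf{ ∫ j* dν : ν a Borel probability measure on Sym_n with support contained in G_k, finite first moment and barycenter ξ } is convex, finite everywhere, and continuous on Sym_n. -/
open MeasureTheory

noncomputable section

/-- The trace (Frobenius) inner product `z·ξ = trace(zξ)` on symmetric matrices. -/
def mdot {n : ℕ} (z ξ : Matrix (Fin n) (Fin n) ℝ) : ℝ := Matrix.trace (z * ξ)

/-- Fenchel conjugate of a function on the space of real symmetric `n×n` matrices: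
`f*(ξ) = sup { z·ξ - f z : z ∈ Sym_n }`. -/
def fstar {n : ℕ} (f : Matrix (Fin n) (Fin n) ℝ → ℝ) (ξ : Matrix (Fin n) (Fin n) ℝ) : ℝ :=
  sSup { r : ℝ | ∃ z : Matrix (Fin n) (Fin n) ℝ, z.IsSymm ∧ r = mdot z ξ - f z }

/-- `j_k(z) = sup { z·ξ - j*(ξ) : ξ ∈ G_k }`, where `G_k` is the set of symmetric
matrices of rank at most `k`. -/
def jk {n : ℕ} (j : Matrix (Fin n) (Fin n) ℝ → ℝ) (k : ℕ) (z : Matrix (Fin n) (Fin n) ℝ) : ℝ :=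
  sSup { r : ℝ | ∃ ξ : Matrix (Fin n) (Fin n) ℝ, ξ.IsSymm ∧ ξ.rank ≤ k ∧
    r = mdot z ξ - fstar j ξ }

instance matMeasurableSpace (n : ℕ) : MeasurableSpace (Matrix (Fin n) (Fin n) ℝ) :=
  (inferInstance : MeasurableSpace (Fin n → Fin n → ℝ))

/-- A measure on the space of `n×n` real matrices has finite first moment if each entry
is integrable. -/
def FiniteFirstMoment {n : ℕ} (ν : Measure (Matrix (Fin n) (Fin n) ℝ)) : Prop :=
  ∀ i j : Fin n, Integrable (fun s : Matrix (Fin n) (Fin n) ℝ => s i j) ν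

/-- The barycenter `[ν] = ∫ s dν(s)` of a measure on matrices, computed entrywise. -/
def bary {n : ℕ} (ν : Measure (Matrix (Fin n) (Fin n) ℝ)) : Matrix (Fin n) (Fin n) ℝ :=
  Matrix.of fun i j => ∫ s, s i j ∂ν

/-- The set of values `∫ j* dν` over Borel probability measures `ν` on `Sym_n` supported
in `G_k` (symmetric matrices of rank ≤ k), with finite first moment and barycenter `ξ`. -/
def gkSet {n : ℕ} (j : Matrix (Fin n) (Fin n) ℝ → ℝ) (k : ℕ)
    (ξ : Matrix (Fin n) (Fin n) ℝ) : Set ℝ :=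
  { r : ℝ | ∃ ν : Measure (Matrix (Fin n) (Fin n) ℝ), IsProbabilityMeasure ν ∧
      ν {s : Matrix (Fin n) (Fin n) ℝ | ¬ (s.IsSymm ∧ s.rank ≤ k)} = 0 ∧
      FiniteFirstMoment ν ∧ bary ν = ξ ∧
      Integrable (fstar j) ν ∧ r = ∫ s, fstar j s ∂ν }

/-- `g_k(ξ) = inf { ∫ j* dν : ν probability on Sym_n, spt ν ⊆ G_k, [ν] = ξ }`. -/
def gk {n : ℕ} (j : Matrix (Fin n) (Fin n) ℝ → ℝ) (k : ℕ)
    (ξ : Matrix (Fin n) (Fin n) ℝ) : ℝ :=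
  sInf (gkSet j k ξ)

open Matrix

lemma fstar_nonneg {n : ℕ} {f : Matrix (Fin n) (Fin n) ℝ → ℝ} (hf : f 0 = 0)
    (ξ : Matrix (Fin n) (Fin n) ℝ) : 0 ≤ fstar f ξ :=
  Real.sSup_nonneg' ⟨0, ⟨0, isSymm_zero, by simp [mdot, hf]⟩, le_rfl⟩

lemma nonneg_of_mem_gkSet {n k : ℕ} {f : Matrix (Fin n) (Fin n) ℝ → ℝ} (hf : f 0 = 0)
    {ξ : Matrix (Fin n) (Fin n) ℝ} {r : ℝ} (hr : r ∈ gkSet f k ξ) : 0 ≤ r := by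
  obtain ⟨ν, -, -, -, -, -, rfl⟩ := hr
  exact integral_nonneg (fstar_nonneg hf)

lemma bddBelow_gkSet {n : ℕ} {f : Matrix (Fin n) (Fin n) ℝ → ℝ} (hf : f 0 = 0) (k : ℕ)
    (ξ : Matrix (Fin n) (Fin n) ℝ) : BddBelow (gkSet f k ξ) :=
  ⟨0, fun _ hr => nonneg_of_mem_gkSet hf hr⟩

lemma fstar_mem_gkSet {n k : ℕ} (f : Matrix (Fin n) (Fin n) ℝ → ℝ)
    {ξ : Matrix (Fin n) (Fin n) ℝ} (hξ : ξ.IsSymm) (hr : ξ.rank ≤ k) :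
    fstar f ξ ∈ gkSet f k ξ := by
  have : MeasurableSingletonClass (Matrix (Fin n) (Fin n) ℝ) :=
    inferInstanceAs (MeasurableSingletonClass (Fin n → Fin n → ℝ))
  refine ⟨Measure.dirac ξ, inferInstance, ?_, fun a b => integrable_dirac (by simp), ?_,
    integrable_dirac (by simp), ?_⟩
  · simp [hξ, hr]
  · ext a b
    simp [bary]
  · simp

lemma convexComb_mem_gkSet {n k : ℕ} {f : Matrix (Fin n) (Fin n) ℝ → ℝ}
    {ξ η : Matrix (Fin n) (Fin n) ℝ} {r s a b : ℝ} (hr : r ∈ gkSet f k ξ)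
    (hs : s ∈ gkSet f k η) (ha : 0 ≤ a) (hb : 0 ≤ b) (hab : a + b = 1) :
    a * r + b * s ∈ gkSet f k (a • ξ + b • η) := by
  obtain ⟨μ, hμ, hμ0, hμ1, rfl, hμi, rfl⟩ := hr
  obtain ⟨ν, hν, hν0, hν1, rfl, hνi, rfl⟩ := hs
  have integrable_comb : ∀ g : Matrix (Fin n) (Fin n) ℝ → ℝ, Integrable g μ → Integrable g ν →
      Integrable g (ENNReal.ofReal a • μ + ENNReal.ofReal b • ν) := fun g h₁ h₂ =>
    (h₁.smul_measure ENNReal.ofReal_ne_top).add_measure (h₂.smul_measure ENNReal.ofReal_ne_top)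
  have integral_comb : ∀ g : Matrix (Fin n) (Fin n) ℝ → ℝ, Integrable g μ → Integrable g ν →
      ∫ x, g x ∂(ENNReal.ofReal a • μ + ENNReal.ofReal b • ν) =
        a * ∫ x, g x ∂μ + b * ∫ x, g x ∂ν := fun g h₁ h₂ => by
    rw [integral_add_measure (h₁.smul_measure ENNReal.ofReal_ne_top)
      (h₂.smul_measure ENNReal.ofReal_ne_top), integral_smul_measure, integral_smul_measure,
      ENNReal.toReal_ofReal ha, ENNReal.toReal_ofReal hb, smul_eq_mul, smul_eq_mul]
  refine ⟨ENNReal.ofReal a • μ + ENNReal.ofReal b • ν, ⟨?_⟩, ?_,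
    fun p q => integrable_comb _ (hμ1 p q) (hν1 p q), ?_, integrable_comb _ hμi hνi,
    (integral_comb _ hμi hνi).symm⟩
  · simp [← ENNReal.ofReal_add ha hb, hab]
  · simp only [Measure.add_apply, Measure.smul_apply, hμ0, hν0, smul_zero, add_zero]
  · ext p q
    simpa [bary] using integral_comb _ (hμ1 p q) (hν1 p q)

lemma convex_isSymm (n : ℕ) : Convex ℝ {ξ : Matrix (Fin n) (Fin n) ℝ | ξ.IsSymm} :=
  fun _ hξ _ hη a b _ _ _ => (hξ.smul a).add (hη.smul b)

lemma convex_gkSet_nonempty {n : ℕ} (f : Matrix (Fin n) (Fin n) ℝ → ℝ) (k : ℕ) :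
    Convex ℝ {ξ : Matrix (Fin n) (Fin n) ℝ | (gkSet f k ξ).Nonempty} :=
  fun _ ⟨_, hr⟩ _ ⟨_, hs⟩ _ _ ha hb hab => ⟨_, convexComb_mem_gkSet hr hs ha hb hab⟩

lemma Matrix.IsSymm.eq_sum_vecMulVec {n : ℕ} {ξ : Matrix (Fin n) (Fin n) ℝ} (hξ : ξ.IsSymm) :
    ∃ (c : Fin n → ℝ) (u : Fin n → Fin n → ℝ), ξ = ∑ i, c i • vecMulVec (u i) (u i) := by
  have hH : ξ.IsHermitian := by rwa [IsHermitian, conjTranspose_eq_transpose_of_trivial]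
  refine ⟨hH.eigenvalues, fun i a => (hH.eigenvectorUnitary : Matrix _ _ ℝ) a i, ?_⟩
  conv_lhs => rw [hH.spectral_theorem, Unitary.conjStarAlgAut_apply]
  ext a b
  rw [mul_apply, sum_apply]
  refine Finset.sum_congr rfl fun i _ => ?_
  rw [mul_diagonal, star_apply, smul_apply, vecMulVec_apply]
  simp only [Function.comp_apply, RCLike.ofReal_real_eq_id, id_eq, star_trivial, smul_eq_mul]
  ring

lemma gkSet_nonempty {n k : ℕ} (hn : 1 ≤ n) (hk : 1 ≤ k) (f : Matrix (Fin n) (Fin n) ℝ → ℝ)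
    {ξ : Matrix (Fin n) (Fin n) ℝ} (hξ : ξ.IsSymm) : (gkSet f k ξ).Nonempty := by
  obtain ⟨c, u, rfl⟩ := hξ.eq_sum_vecMulVec
  have hn0 : (n : ℝ) ≠ 0 := by positivity
  have hmem := (convex_gkSet_nonempty f k).sum_mem (t := Finset.univ)
    (w := fun _ : Fin n => (n : ℝ)⁻¹) (z := fun i => vecMulVec ((n * c i) • u i) (u i))
    (fun _ _ => by positivity) (by simp [hn0]) fun i _ =>
      ⟨_, fstar_mem_gkSet f (by
        rw [smul_vecMulVec]
        exact IsSymm.smul (by ext a b; simp [vecMulVec_apply, mul_comm]) _)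
        ((rank_vecMulVec_le _ _).trans hk)⟩
  simpa [smul_vecMulVec, smul_smul, hn0] using hmem

lemma convexOn_gk {n k : ℕ} (hn : 1 ≤ n) (hk : 1 ≤ k) {f : Matrix (Fin n) (Fin n) ℝ → ℝ}
    (hf : f 0 = 0) : ConvexOn ℝ {ξ : Matrix (Fin n) (Fin n) ℝ | ξ.IsSymm} (gk f k) := by
  refine ⟨convex_isSymm n, fun ξ hξ η hη a b ha hb hab => ?_⟩
  refine le_of_forall_pos_le_add fun ε hε => ?_
  obtain ⟨r, hr, hrlt⟩ := exists_lt_of_csInf_lt (gkSet_nonempty hn hk f hξ)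
    (lt_add_of_pos_right (gk f k ξ) hε)
  obtain ⟨s, hs, hslt⟩ := exists_lt_of_csInf_lt (gkSet_nonempty hn hk f hη)
    (lt_add_of_pos_right (gk f k η) hε)
  calc gk f k (a • ξ + b • η) ≤ a * r + b * s :=
        csInf_le (bddBelow_gkSet hf k _) (convexComb_mem_gkSet hr hs ha hb hab)
    _ ≤ a * (gk f k ξ + ε) + b * (gk f k η + ε) := by gcongr
    _ = a • gk f k ξ + b • gk f k η + ε := by
        simp only [smul_eq_mul]
        linear_combination ε * hab

/-- The orthogonal projection of matrices onto symmetric matrices. -/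
def symPart (n : ℕ) : Matrix (Fin n) (Fin n) ℝ →ₗ[ℝ] Matrix (Fin n) (Fin n) ℝ :=
  (2⁻¹ : ℝ) • (LinearMap.id + (transposeLinearEquiv (Fin n) (Fin n) ℝ ℝ).toLinearMap)

lemma symPart_isSymm {n : ℕ} (ξ : Matrix (Fin n) (Fin n) ℝ) : (symPart n ξ).IsSymm := by
  simp [symPart, IsSymm, add_comm]

lemma symPart_eq_self {n : ℕ} {ξ : Matrix (Fin n) (Fin n) ℝ} (hξ : ξ.IsSymm) :
    symPart n ξ = ξ := by
  ext a b
  simp [symPart, hξ.eq]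
  ring

lemma ConvexOn.continuousOn_isSymm {n : ℕ} {g : Matrix (Fin n) (Fin n) ℝ → ℝ}
    (hg : ConvexOn ℝ {ξ | ξ.IsSymm} g) : ContinuousOn g {ξ | ξ.IsSymm} := by
  have hconv : ConvexOn ℝ Set.univ (g ∘ symPart n) :=
    (hg.comp_linearMap (symPart n)).subset (fun ξ _ => symPart_isSymm ξ) convex_univ
  have hcont : ContinuousOn (g ∘ symPart n) Set.univ :=
    ConvexOn.continuousOn (E := Fin n → Fin n → ℝ) isOpen_univ hconv
  exact (hcont.mono (Set.subset_univ _)).congr fun ξ hξ => by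
    simp [symPart_eq_self hξ]

/-- for every `1 ≤ k ≤ n`, the function `g_k` is convex, finite everywhere
(the defining infimum runs over a nonempty set of values which is bounded below), and
continuous on `Sym_n`. -/
theorem gk_convex_finite_continuous (n : ℕ) (hn : 1 ≤ n) (j : Matrix (Fin n) (Fin n) ℝ → ℝ)
    (hquad : ∃ Q : QuadraticForm ℝ (Matrix (Fin n) (Fin n) ℝ),
      ∀ z : Matrix (Fin n) (Fin n) ℝ, z.IsSymm → j z = Q z)
    (hpos : ∀ z : Matrix (Fin n) (Fin n) ℝ, z.IsSymm → z ≠ 0 → 0 < j z)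
    (k : ℕ) (hk1 : 1 ≤ k) (hkn : k ≤ n) :
    ConvexOn ℝ {ξ : Matrix (Fin n) (Fin n) ℝ | ξ.IsSymm} (gk j k) ∧
    (∀ ξ : Matrix (Fin n) (Fin n) ℝ, ξ.IsSymm →
      (gkSet j k ξ).Nonempty ∧ BddBelow (gkSet j k ξ)) ∧
    ContinuousOn (gk j k) {ξ : Matrix (Fin n) (Fin n) ℝ | ξ.IsSymm} := by
  obtain ⟨Q, hQ⟩ := hquad
  have hj : j 0 = 0 := by rw [hQ 0 isSymm_zero, QuadraticMap.map_zero]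
  have hconv := convexOn_gk hn hk1 hj
  exact ⟨hconv, fun ξ hξ => ⟨gkSet_nonempty hn hk1 j hξ, bddBelow_gkSet hj k ξ⟩,
    hconv.continuousOn_isSymm⟩
end
end

section
/- Let ν be a Borel probability measure on Sym_n with finite first moment and barycenter [ν]. Suppose there exist a Borel probability measure ν₀ on Sym_n supported in { ξ ∈ Sym_n : det ξ = 0 } with finite first moment, and a measurable family (λ_ξ) of Borel probability measures on Sym_n with finite first moments such that for ν₀-almost every ξ the barycenter of λ_ξ equals ξ, and ν is the mixture of the λ_ξ over ν₀, i.e. ∫ Ψ dν = ∫ ( ∫ Ψ(y) dλ_ξ(y) ) dν₀(ξ) for every bounded continuous Ψ : Sym_n → ℝ. Then ∫ j*(ξ) dν(ξ) ≥ (\bar j)*([ν]). -/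
open MeasureTheory

noncomputable section

open scoped ProbabilityTheory

/-- On a finite-dimensional space, a linear form minus a positive definite quadratic form is
bounded above. -/
lemma QuadraticMap.PosDef.exists_sub_le {V : Type*} [AddCommGroup V] [Module ℝ V]
    [FiniteDimensional ℝ V] {Q : QuadraticForm ℝ V} (hQ : Q.PosDef) (L : V →ₗ[ℝ] ℝ) :
    ∃ C : ℝ, ∀ z, L z - Q z ≤ C := by
  set B : LinearMap.BilinForm ℝ V := QuadraticMap.associated Q with hB
  have hBQ : ∀ x, B x x = Q x := fun x ↦ QuadraticMap.associated_eq_self_apply ℝ Q x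
  have hBsymm : ∀ x y, B x y = B y x := fun x y ↦ QuadraticMap.associated_isSymm ℝ Q x y
  have hinj : Function.Injective B := by
    rw [injective_iff_map_eq_zero]
    intro x hx
    exact hQ.anisotropic x (by rw [← hBQ, hx, LinearMap.zero_apply])
  obtain ⟨w, hw⟩ := (LinearMap.injective_iff_surjective_of_finrank_eq_finrank
    Subspace.dual_finrank_eq.symm).1 hinj ((1 / 2 : ℝ) • L)
  refine ⟨Q w, fun z ↦ ?_⟩
  have hL : B w z = 1 / 2 * L z := by rw [hw]; simp
  have hnonneg : 0 ≤ B (z - w) (z - w) := by rw [hBQ]; exact hQ.nonneg _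
  simp only [map_sub, LinearMap.sub_apply, hBsymm z w, hBQ, hL] at hnonneg
  linarith

lemma Matrix.rank_le_pred_of_det_eq_zero {n : ℕ} {A : Matrix (Fin n) (Fin n) ℝ} (h : A.det = 0) :
    A.rank ≤ n - 1 := by
  obtain ⟨v, hv0, hv⟩ := Matrix.exists_mulVec_eq_zero_iff.2 h
  have hker : A.mulVecLin.ker ≠ ⊥ := fun hbot ↦ hv0 <| by
    have : v ∈ A.mulVecLin.ker := by simpa using hv
    rwa [hbot, Submodule.mem_bot] at this
  have hpos := Submodule.one_le_finrank_iff.2 hker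
  have hsum := A.mulVecLin.finrank_range_add_finrank_ker
  rw [Module.finrank_fin_fun] at hsum
  change Module.finrank ℝ A.mulVecLin.range ≤ n - 1
  omega

section Mdot

variable {n : ℕ}

lemma mdot_eq_sum (z ξ : Matrix (Fin n) (Fin n) ℝ) :
    mdot z ξ = ∑ a, ∑ b, z a b * ξ b a := by
  simp [mdot, Matrix.trace, Matrix.mul_apply]

lemma continuous_mdot (z : Matrix (Fin n) (Fin n) ℝ) : Continuous (mdot z) := by
  unfold mdot
  fun_prop

lemma integrable_mdot {μ : Measure (Matrix (Fin n) (Fin n) ℝ)} (hμ : FiniteFirstMoment μ)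
    (z : Matrix (Fin n) (Fin n) ℝ) : Integrable (mdot z) μ := by
  simp only [funext (mdot_eq_sum z)]
  exact integrable_finsetSum _ fun a _ ↦ integrable_finsetSum _ fun b _ ↦ (hμ b a).const_mul _

lemma integral_mdot {μ : Measure (Matrix (Fin n) (Fin n) ℝ)} (hμ : FiniteFirstMoment μ)
    (z : Matrix (Fin n) (Fin n) ℝ) : ∫ s, mdot z s ∂μ = mdot z (bary μ) := by
  simp only [mdot_eq_sum]
  have hentry (a b : Fin n) : Integrable (fun s : Matrix (Fin n) (Fin n) ℝ ↦ z a b * s b a) μ :=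
    (hμ b a).const_mul _
  refine (integral_finsetSum Finset.univ fun a _ ↦
    integrable_finsetSum Finset.univ fun b _ ↦ hentry a b).trans ?_
  refine Finset.sum_congr rfl fun a _ ↦ ?_
  refine (integral_finsetSum Finset.univ fun b _ ↦ hentry a b).trans ?_
  exact Finset.sum_congr rfl fun b _ ↦ integral_const_mul _ _

end Mdot

/-- The Borel σ-algebra on matrices is the product one. -/
instance matBorelSpace (n : ℕ) : BorelSpace (Matrix (Fin n) (Fin n) ℝ) :=
  inferInstanceAs (BorelSpace (Fin n → Fin n → ℝ))

instance matHasOuterApproxClosed (n : ℕ) : HasOuterApproxClosed (Matrix (Fin n) (Fin n) ℝ) :=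
  inferInstanceAs (HasOuterApproxClosed (Fin n → Fin n → ℝ))

section Conjugate

variable {n : ℕ} {f : Matrix (Fin n) (Fin n) ℝ → ℝ}

/-- The affine functions whose supremum is the Fenchel conjugate of `f` are pointwise bounded. -/
def ConjBdd (f : Matrix (Fin n) (Fin n) ℝ → ℝ) : Prop :=
  ∀ ξ, BddAbove {r : ℝ | ∃ z : Matrix (Fin n) (Fin n) ℝ, z.IsSymm ∧ r = mdot z ξ - f z}

/-- The symmetric matrices as a linear subspace. -/
def symmSubmodule (n : ℕ) : Submodule ℝ (Matrix (Fin n) (Fin n) ℝ) where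
  carrier := {z | z.IsSymm}
  add_mem' ha hb := ha.add hb
  zero_mem' := Matrix.isSymm_zero
  smul_mem' c _ ha := ha.smul c

lemma conjBdd_of_quadraticForm
    (hquad : ∃ Q : QuadraticForm ℝ (Matrix (Fin n) (Fin n) ℝ),
      ∀ z : Matrix (Fin n) (Fin n) ℝ, z.IsSymm → f z = Q z)
    (hpos : ∀ z : Matrix (Fin n) (Fin n) ℝ, z.IsSymm → z ≠ 0 → 0 < f z) :
    ConjBdd f := by
  obtain ⟨Q, hQ⟩ := hquad
  intro ξ
  have hdef : (Q.comp (symmSubmodule n).subtype).PosDef := fun x hx ↦ by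
    have := hpos x x.2 (by simpa using hx)
    rwa [hQ _ x.2] at this
  let L : Matrix (Fin n) (Fin n) ℝ →ₗ[ℝ] ℝ :=
    Matrix.traceLinearMap (Fin n) ℝ ℝ ∘ₗ LinearMap.mulRight ℝ ξ
  obtain ⟨C, hC⟩ := hdef.exists_sub_le (L ∘ₗ (symmSubmodule n).subtype)
  refine ⟨C, ?_⟩
  rintro _ ⟨z, hz, rfl⟩
  rw [hQ z hz]
  exact hC ⟨z, hz⟩

lemma ConjBdd.le_fstar (hf : ConjBdd f) {z : Matrix (Fin n) (Fin n) ℝ} (hz : z.IsSymm)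
    (ξ : Matrix (Fin n) (Fin n) ℝ) : mdot z ξ - f z ≤ fstar f ξ :=
  le_csSup (hf ξ) ⟨z, hz, rfl⟩

lemma ConjBdd.measurable_fstar (hf : ConjBdd f) : Measurable (fstar f) := by
  have hset : ∀ ξ, {r : ℝ | ∃ z : Matrix (Fin n) (Fin n) ℝ, z.IsSymm ∧ r = mdot z ξ - f z} =
      Set.range fun z : {z : Matrix (Fin n) (Fin n) ℝ // z.IsSymm} ↦ mdot z.1 ξ - f z.1 := by
    intro ξ
    ext r
    simp [eq_comm]
  have hsup : fstar f = fun ξ ↦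
      ⨆ z : {z : Matrix (Fin n) (Fin n) ℝ // z.IsSymm}, (mdot z.1 ξ - f z.1) :=
    funext fun ξ ↦ congrArg sSup (hset ξ)
  rw [hsup]
  refine (lowerSemicontinuous_ciSup (fun ξ ↦ hset ξ ▸ hf ξ) fun z ↦ ?_).measurable
  exact ((continuous_mdot z.1).sub continuous_const).lowerSemicontinuous

/-- Jensen's inequality for a Fenchel conjugate. -/
lemma ConjBdd.fstar_bary_le (hf : ConjBdd f) {μ : Measure (Matrix (Fin n) (Fin n) ℝ)}
    [IsProbabilityMeasure μ] (hμ : FiniteFirstMoment μ) (hint : Integrable (fstar f) μ) :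
    fstar f (bary μ) ≤ ∫ s, fstar f s ∂μ := by
  refine csSup_le ⟨_, 0, Matrix.isSymm_zero, rfl⟩ ?_
  rintro _ ⟨z, hz, rfl⟩
  calc mdot z (bary μ) - f z = ∫ s, (mdot z s - f z) ∂μ := by
        rw [integral_sub (integrable_mdot hμ z) (integrable_const _), integral_mdot hμ]
        simp
    _ ≤ ∫ s, fstar f s ∂μ := integral_mono ((integrable_mdot hμ z).sub (integrable_const _)) hint
        fun s ↦ hf.le_fstar hz s

lemma ConjBdd.mdot_sub_fstar_le_jk (hf : ConjBdd f) {k : ℕ} {z ξ : Matrix (Fin n) (Fin n) ℝ}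
    (hz : z.IsSymm) (hξ : ξ.IsSymm) (hrank : ξ.rank ≤ k) :
    mdot z ξ - fstar f ξ ≤ jk f k z := by
  refine le_csSup ⟨f z, ?_⟩ ⟨ξ, hξ, hrank, rfl⟩
  rintro _ ⟨η, -, -, rfl⟩
  linarith [hf.le_fstar hz η]

end Conjugate

/-- A function whose integral against almost every component of a mixture is at most `c` has
integral at most `c` against the mixture. -/
lemma MeasureTheory.Measure.integral_bind_le {α β : Type*} {mα : MeasurableSpace α}
    {mβ : MeasurableSpace β} {μ : Measure α} [IsProbabilityMeasure μ]
    {κ : ProbabilityTheory.Kernel α β} {g : β → ℝ} {c : ℝ} (hg : Integrable g (κ ∘ₘ μ))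
    (hc : ∀ᵐ x ∂μ, ∫ y, g y ∂κ x ≤ c) : ∫ y, g y ∂(κ ∘ₘ μ) ≤ c := by
  rw [Measure.comp_eq_comp_const_apply] at hg ⊢
  have hint := hg.integral_comp
  rw [ProbabilityTheory.Kernel.integral_comp hg]
  simp only [ProbabilityTheory.Kernel.const_apply] at hint ⊢
  simpa using integral_mono_ae hint (integrable_const c) hc

/-- A finite measure whose integrals of bounded continuous functions are those of a mixture is
that mixture. -/
lemma eq_bind_of_forall_integral_eq {α Ω : Type*} {mα : MeasurableSpace α} [MeasurableSpace Ω]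
    [TopologicalSpace Ω] [HasOuterApproxClosed Ω] [BorelSpace Ω] {ν : Measure Ω}
    [IsFiniteMeasure ν] {μ : Measure α} [IsProbabilityMeasure μ] {κ : ProbabilityTheory.Kernel α Ω}
    [ProbabilityTheory.IsMarkovKernel κ]
    (h : ∀ Ψ : Ω → ℝ, Continuous Ψ → (∃ C : ℝ, ∀ y, |Ψ y| ≤ C) →
      ∫ s, Ψ s ∂ν = ∫ x, (∫ y, Ψ y ∂(κ x)) ∂μ) : ν = κ ∘ₘ μ := by
  refine ext_of_forall_integral_eq_of_IsFiniteMeasure fun Ψ ↦ ?_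
  have hΨ : Integrable Ψ (κ ∘ₘ μ) := Ψ.integrable _
  rw [h Ψ Ψ.continuous ⟨‖Ψ‖, Ψ.norm_coe_le_norm⟩]
  rw [Measure.comp_eq_comp_const_apply] at hΨ ⊢
  rw [ProbabilityTheory.Kernel.integral_comp hΨ, ProbabilityTheory.Kernel.const_apply]

/-- if a probability measure `ν` on `Sym_n` with finite first moment is a
mixture `∫ Ψ dν = ∫ (∫ Ψ dλ_ξ) dν₀(ξ)` of a measurable family `(λ_ξ)` of probability
measures with finite first moments whose barycenters satisfy `[λ_ξ] = ξ` for `ν₀`-a.e.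
`ξ`, where `ν₀` is a probability measure supported in `{det = 0}` with finite first
moment, then `∫ j* dν ≥ (\bar j)*([ν])`, where `\bar j := j_{n-1}`
(the integral of the nonnegative function `j*` is taken in `[0,∞]`). -/
theorem integral_jstar_ge_of_mixture (n : ℕ) (hn : 1 ≤ n)
    (j : Matrix (Fin n) (Fin n) ℝ → ℝ)
    (hquad : ∃ Q : QuadraticForm ℝ (Matrix (Fin n) (Fin n) ℝ),
      ∀ z : Matrix (Fin n) (Fin n) ℝ, z.IsSymm → j z = Q z)
    (hpos : ∀ z : Matrix (Fin n) (Fin n) ℝ, z.IsSymm → z ≠ 0 → 0 < j z)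
    (ν ν₀ : Measure (Matrix (Fin n) (Fin n) ℝ))
    (hprob : IsProbabilityMeasure ν) (hprob0 : IsProbabilityMeasure ν₀)
    (hsym : ν {s : Matrix (Fin n) (Fin n) ℝ | ¬ s.IsSymm} = 0)
    (hsym0 : ν₀ {s : Matrix (Fin n) (Fin n) ℝ | ¬ s.IsSymm} = 0)
    (hmom : FiniteFirstMoment ν) (hmom0 : FiniteFirstMoment ν₀)
    (hdet0 : ν₀ {ξ : Matrix (Fin n) (Fin n) ℝ | ξ.det ≠ 0} = 0)
    (lam : Matrix (Fin n) (Fin n) ℝ → Measure (Matrix (Fin n) (Fin n) ℝ))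
    (hmeas : Measurable lam)
    (hlamprob : ∀ ξ : Matrix (Fin n) (Fin n) ℝ, IsProbabilityMeasure (lam ξ))
    (hlammom : ∀ ξ : Matrix (Fin n) (Fin n) ℝ, FiniteFirstMoment (lam ξ))
    (hbar : ∀ᵐ ξ ∂ν₀, bary (lam ξ) = ξ)
    (hmixture : ∀ Ψ : Matrix (Fin n) (Fin n) ℝ → ℝ, Continuous Ψ →
      (∃ C : ℝ, ∀ y : Matrix (Fin n) (Fin n) ℝ, |Ψ y| ≤ C) →
      ∫ s, Ψ s ∂ν = ∫ ξ, (∫ y, Ψ y ∂(lam ξ)) ∂ν₀) :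
    ENNReal.ofReal (fstar (jk j (n - 1)) (bary ν))
      ≤ ∫⁻ s, ENNReal.ofReal (fstar j s) ∂ν := by
  have hbdd := conjBdd_of_quadraticForm hquad hpos
  have hj0 : j 0 = 0 := by
    obtain ⟨Q, hQ⟩ := hquad
    rw [hQ 0 Matrix.isSymm_zero, QuadraticMap.map_zero]
  have hnonneg : ∀ ξ, 0 ≤ fstar j ξ := fun ξ ↦ by
    simpa [hj0, mdot] using hbdd.le_fstar Matrix.isSymm_zero ξ
  have hmeasj := hbdd.measurable_fstar
  rcases eq_or_ne (∫⁻ s, ENNReal.ofReal (fstar j s) ∂ν) ⊤ with htop | htop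
  · simp [htop]
  have hint : Integrable (fstar j) ν :=
    (lintegral_ofReal_ne_top_iff_integrable hmeasj.aestronglyMeasurable
      (ae_of_all _ hnonneg)).1 htop
  rw [← ofReal_integral_eq_lintegral_ofReal hint (ae_of_all _ hnonneg)]
  let κ : ProbabilityTheory.Kernel (Matrix (Fin n) (Fin n) ℝ) (Matrix (Fin n) (Fin n) ℝ) :=
    ⟨lam, hmeas⟩
  have : ProbabilityTheory.IsMarkovKernel κ := ⟨hlamprob⟩
  have hν : ν = κ ∘ₘ ν₀ := eq_bind_of_forall_integral_eq hmixture
  have hae : ∀ᵐ ξ ∂ν₀, Integrable (fstar j) (lam ξ) :=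
    Measure.ae_integrable_of_integrable_comp (κ := κ) (hν ▸ hint)
  refine ENNReal.ofReal_le_ofReal (Real.sSup_le ?_ (integral_nonneg hnonneg))
  rintro _ ⟨z, hz, rfl⟩
  have hg : Integrable (fun s ↦ mdot z s - fstar j s) ν := (integrable_mdot hmom z).sub hint
  have hle : ∫ s, (mdot z s - fstar j s) ∂ν ≤ jk j (n - 1) z := by
    rw [hν] at hg ⊢
    refine Measure.integral_bind_le hg ?_
    filter_upwards [hae, hbar, ae_iff.2 hsym0, ae_iff.2 hdet0] with ξ hξ hb hs hd
    change ∫ y, (mdot z y - fstar j y) ∂(lam ξ) ≤ _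
    have := hlamprob ξ
    rw [integral_sub (integrable_mdot (hlammom ξ) z) hξ, integral_mdot (hlammom ξ), hb]
    have hjensen := hbdd.fstar_bary_le (hlammom ξ) hξ
    rw [hb] at hjensen
    linarith [hbdd.mdot_sub_fstar_le_jk hz hs (Matrix.rank_le_pred_of_det_eq_zero hd)]
  rw [integral_sub (integrable_mdot hmom z) hint, integral_mdot hmom] at hle
  linarith
end
end
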